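/- (Proposition 1, net flows.) Let r : Fin (k+1) → X be limiting profiles satisfying Condition 2 (g (r h) j ≥ g (r l) j for all criteria j whenever h < l) and Condition 7.B (π(r h, r (h+1)) > 0 for every h < k), all profiles pairwise distinct, and let a be an alternative distinct from all profiles. Then for every h < k, the net Choquet-flows over R_a = {r 0, …, r k, a} satisfy the strict inequality φ_{R_a}(r h) > φ_{R_a}(r (h+1)). -/

import Mathlib

open Finset

/-- The 2-additive Choquet integral (Möbius form). -/
noncomputable def CI2 (n : ℕ) (m : Fin n → ℝ) (M : Fin n → Fin n → ℝ)
    (P : Fin n → ℝ) : ℝ :=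
  ∑ j, m j * P j + ∑ j, ∑ s, if j < s then M j s * min (P j) (P s) else 0

/-- The Choquet-outranking degree of `x` over `y` built from evaluations `g` and
preference functions `F`. -/
noncomputable def outrank {X : Type*} (n : ℕ) (m : Fin n → ℝ) (M : Fin n → Fin n → ℝ)
    (g : X → Fin n → ℝ) (F : Fin n → ℝ → ℝ) (x y : X) : ℝ :=
  CI2 n m M (fun j => F j (g x j - g y j))

/-- The positive Choquet-flow of `x` within the finite set `S`. -/
noncomputable def posFlow {X : Type*} [DecidableEq X] (π : X → X → ℝ)
    (S : Finset X) (x : X) : ℝ :=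
  (1 / ((S.card : ℝ) - 1)) * ∑ y ∈ S.erase x, π x y

/-- The negative Choquet-flow of `x` within the finite set `S`. -/
noncomputable def negFlow {X : Type*} [DecidableEq X] (π : X → X → ℝ)
    (S : Finset X) (x : X) : ℝ :=
  (1 / ((S.card : ℝ) - 1)) * ∑ y ∈ S.erase x, π y x

/-- The net Choquet-flow of `x` within the finite set `S`. -/
noncomputable def netFlow {X : Type*} [DecidableEq X] (π : X → X → ℝ)
    (S : Finset X) (x : X) : ℝ :=
  posFlow π S x - negFlow π S x

/-- A sum over ordered pairs of symmetric weights with zero diagonal, grouped by unordered pairs. -/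
theorem sum_lt_mul_add_swap {n : ℕ} {M : Fin n → Fin n → ℝ}
    (hsymm : ∀ j s, M j s = M s j) (hdiag : ∀ j, M j j = 0) (c : Fin n → Fin n → ℝ) :
    (∑ j, ∑ s, if j < s then M j s * (c j s + c s j) else 0) = ∑ j, ∑ s, M j s * c j s := by
  have hsplit : (∑ j, ∑ s, if j < s then M j s * (c j s + c s j) else 0)
      = (∑ j, ∑ s, if j < s then M j s * c j s else 0)
        + ∑ j, ∑ s, if j < s then M j s * c s j else 0 := by
    simp only [← Finset.sum_add_distrib]
    refine Finset.sum_congr rfl fun j _ => Finset.sum_congr rfl fun s _ => ?_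
    split_ifs <;> ring
  rw [hsplit, Finset.sum_comm (f := fun j s => if j < s then M j s * c s j else 0)]
  simp only [← Finset.sum_add_distrib]
  refine Finset.sum_congr rfl fun j _ => Finset.sum_congr rfl fun s _ => ?_
  rcases lt_trichotomy j s with h | rfl | h
  · simp [h, h.not_gt]
  · simp [hdiag]
  · simp [h, h.not_gt, hsymm j s]

/-- Monotonicity of the capacity bounds every combination of the interactions of a criterion with
coefficients between `0` and `δ`. -/
theorem mul_add_sum_mul_nonneg {ι : Type*} [Fintype ι] {j : ι} {μ δ : ℝ} {w c : ι → ℝ}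
    (hj : w j = 0) (hmono : ∀ S : Finset ι, j ∉ S → 0 ≤ μ + ∑ s ∈ S, w s)
    (hδ : 0 ≤ δ) (hc : ∀ s, 0 ≤ c s ∧ c s ≤ δ) : 0 ≤ μ * δ + ∑ s, w s * c s := by
  classical
  have hneg : (∑ s ∈ univ.filter (fun s => w s < 0), w s) * δ ≤ ∑ s, w s * c s := by
    rw [Finset.sum_mul, Finset.sum_filter]
    refine Finset.sum_le_sum fun s _ => ?_
    split_ifs with h
    · exact mul_le_mul_of_nonpos_left (hc s).2 h.le
    · exact mul_nonneg (not_lt.mp h) (hc s).1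
  have hcap := mul_nonneg (hmono (univ.filter fun s => w s < 0) (by simp [hj])) hδ
  linarith

theorem min_sub_min_mem {p q t : ℝ} (h : p ≤ q) :
    0 ≤ min q t - min p t ∧ min q t - min p t ≤ q - p := by
  constructor
  · linarith [min_le_min_right t h]
  · rcases le_total p t with hp | hp
    · linarith [min_eq_left hp, min_le_left q t]
    · linarith [min_eq_right hp, min_le_right q t]

theorem CI2_mono {n : ℕ} {m : Fin n → ℝ} {M : Fin n → Fin n → ℝ}
    (hsymm : ∀ j s, M j s = M s j) (hdiag : ∀ j, M j j = 0)
    (hmono : ∀ j (S : Finset (Fin n)), j ∉ S → 0 ≤ m j + ∑ s ∈ S, M j s) :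
    Monotone (CI2 n m M) := by
  intro P Q hPQ
  let c : Fin n → Fin n → ℝ := fun j s =>
    ((min (Q j) (P s) - min (P j) (P s)) + (min (Q j) (Q s) - min (P j) (Q s))) / 2
  have hdiff : CI2 n m M Q - CI2 n m M P
      = ∑ j, (m j * (Q j - P j) + ∑ s, M j s * c j s) := by
    rw [Finset.sum_add_distrib, ← sum_lt_mul_add_swap hsymm hdiag c, CI2, CI2,
      add_sub_add_comm]
    simp only [← Finset.sum_sub_distrib]
    congr 1
    · exact Finset.sum_congr rfl fun j _ => by ring
    · refine Finset.sum_congr rfl fun j _ => Finset.sum_congr rfl fun s _ => ?_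
      split_ifs
      · simp only [c]
        rw [min_comm (Q s) (P j), min_comm (P s) (P j), min_comm (Q s) (Q j),
          min_comm (P s) (Q j)]
        ring
      · simp
  rw [← sub_nonneg, hdiff]
  refine Finset.sum_nonneg fun j _ => ?_
  refine mul_add_sum_mul_nonneg (hdiag j) (hmono j) (sub_nonneg.mpr (hPQ j)) fun s => ?_
  have h₁ := min_sub_min_mem (t := P s) (hPQ j)
  have h₂ := min_sub_min_mem (t := Q s) (hPQ j)
  simp only [c]
  constructor <;> linarith

theorem outrank_self {X : Type*} {n : ℕ} (m : Fin n → ℝ) (M : Fin n → Fin n → ℝ)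
    (g : X → Fin n → ℝ) {F : Fin n → ℝ → ℝ} (hF : ∀ j, F j 0 = 0) (x : X) :
    outrank n m M g F x x = 0 := by
  simp [outrank, CI2, hF]

/-- If `x` dominates `y` under a degree vanishing on the diagonal, and is strictly preferred to it,
then `x` has the larger net flow. -/
theorem netFlow_lt_netFlow {X : Type*} [DecidableEq X] {π : X → X → ℝ} {S : Finset X} {x y : X}
    (hself : ∀ z, π z z = 0) (hx : x ∈ S) (hy : y ∈ S)
    (hleft : ∀ z, π y z ≤ π x z) (hright : ∀ z, π z x ≤ π z y) (hxy : 0 < π x y) :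
    netFlow π S y < netFlow π S x := by
  have hne : x ≠ y := fun h => by simp [h, hself] at hxy
  have hcard : (1 : ℝ) < S.card := by
    exact_mod_cast Finset.one_lt_card.mpr ⟨x, hx, y, hy, hne⟩
  have hpos : 0 < 1 / ((S.card : ℝ) - 1) := one_div_pos.mpr (sub_pos.mpr hcard)
  simp only [netFlow, posFlow, negFlow, ← mul_sub, Finset.sum_erase S (f := π x) (hself x),
    Finset.sum_erase S (f := π y) (hself y), Finset.sum_erase S (f := fun z => π z x) (hself x),
    Finset.sum_erase S (f := fun z => π z y) (hself y)]
  have hout : ∑ z ∈ S, π y z < ∑ z ∈ S, π x z :=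
    Finset.sum_lt_sum (fun z _ => hleft z) ⟨y, hy, by rwa [hself]⟩
  have hin : ∑ z ∈ S, π z x ≤ ∑ z ∈ S, π z y := Finset.sum_le_sum fun z _ => hright z
  exact mul_lt_mul_of_pos_left (by linarith) hpos

/-- Proposition 1, net flows: the net Choquet-flows of the reference
profiles strictly decrease along the ordered categories, within
`R_a = {r 0, …, r k, a}`. -/
theorem prop1_netFlow {X : Type*} [DecidableEq X] (n k : ℕ)
    (m : Fin n → ℝ) (M : Fin n → Fin n → ℝ)
    (hsymm : ∀ j s, M j s = M s j) (hdiag : ∀ j, M j j = 0)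
    (hmono1 : ∀ j, 0 ≤ m j)
    (hmono2 : ∀ j (S : Finset (Fin n)), j ∉ S → 0 ≤ m j + ∑ s ∈ S, M j s)
    (g : X → Fin n → ℝ) (F : Fin n → ℝ → ℝ)
    (hF1 : ∀ j, Monotone (F j))
    (hF2 : ∀ j d, 0 ≤ F j d ∧ F j d ≤ 1)
    (hF3 : ∀ j d, d ≤ 0 → F j d = 0)
    (r : Fin (k + 1) → X)
    (hinj : Function.Injective r)
    (hcond2 : ∀ h l : Fin (k + 1), h < l → ∀ j, g (r l) j ≤ g (r h) j)
    (hcond7B : ∀ h : Fin k,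
      0 < outrank n m M g F (r h.castSucc) (r h.succ))
    (a : X) (ha : ∀ h, a ≠ r h) :
    ∀ h : Fin k,
      netFlow (outrank n m M g F) (insert a (Finset.image r Finset.univ)) (r h.succ)
        < netFlow (outrank n m M g F) (insert a (Finset.image r Finset.univ))
          (r h.castSucc) := by
  intro h
  have hdom := hcond2 h.castSucc h.succ h.castSucc_lt_succ
  have hCI := CI2_mono hsymm hdiag hmono2
  exact netFlow_lt_netFlow (outrank_self m M g fun j => hF3 j 0 le_rfl) (by simp) (by simp)
    (fun z => hCI fun j => hF1 j (by linarith [hdom j]))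
    (fun z => hCI fun j => hF1 j (by linarith [hdom j])) (hcond7B h)
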